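/- Let f : [0,1]^n → ℝ be differentiable and DR-submodular (its gradient is antitone). Let A ∈ ℝ^{m×n} have nonnegative entries, let η ∈ (0, 1/2] and λ > 0. Let x, z ∈ ℝ^n be nonnegative with x ≤ z coordinatewise, (1+η)x ∈ [0,1]^n, and ‖Az‖_∞ ≤ 1. Define c_i = max((1 − x_i)·∇_i f((1+η)x), 0), m_i = max(1 − λ·(Aᵀ∇smax_η(Az))_i / c_i, 0) when c_i > 0 and m_i = 0 when c_i = 0, and d = η·(x ∘ m) (coordinatewise product). Assume (1/η)·‖Ad‖_∞ ≤ 1/2. Then f(x + d ∘ (1 − x)) − f(x) ≥ λ·(smax_η(A(z + d)) − smax_η(Az)), where (d ∘ (1 − x))_i = d_i·(1 − x_i). -/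

import Mathlib

/-- The `i`-th coordinate of the gradient of `f : ℝ^n → ℝ` at `x`. -/
noncomputable def fgrad {n : ℕ} (f : (Fin n → ℝ) → ℝ) (x : Fin n → ℝ) (i : Fin n) : ℝ :=
  fderiv ℝ f x (Pi.single i 1)

/-- The softmax function `smax_η(z) = η ln(∑_j e^{z_j/η})`. -/
noncomputable def smax {m : ℕ} (η : ℝ) (z : Fin m → ℝ) : ℝ :=
  η * Real.log (∑ j, Real.exp (z j / η))

/-- The `j`-th coordinate of the gradient of the softmax function. -/
noncomputable def smaxGrad {m : ℕ} (η : ℝ) (z : Fin m → ℝ) (j : Fin m) : ℝ :=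
  Real.exp (z j / η) / ∑ l, Real.exp (z l / η)

/-- The directional derivative of `f` at `x` along `v` in terms of the coordinates of its gradient. -/
theorem fderiv_eq_sum_fgrad {n : ℕ} (f : (Fin n → ℝ) → ℝ) (x v : Fin n → ℝ) :
    fderiv ℝ f x v = ∑ i, v i * fgrad f x i := by
  have h := LinearMap.pi_apply_eq_sum_univ (fderiv ℝ f x).toLinearMap v
  simp only [ContinuousLinearMap.coe_coe, smul_eq_mul] at h
  rw [h]
  refine Finset.sum_congr rfl fun i _ => ?_
  rw [fgrad]
  congr 2
  funext j
  simp [Pi.single_apply, eq_comm]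

/-- A function with antitone gradient increases along a segment `[x, y]` with `x ≤ y ≤ w` at least
at the rate given by its gradient at `w`. -/
theorem sum_mul_fgrad_le_sub {n : ℕ} {f : (Fin n → ℝ) → ℝ} (hf : Differentiable ℝ f)
    (hDR : ∀ x y : Fin n → ℝ, (∀ i, x i ∈ Set.Icc (0:ℝ) 1) →
      (∀ i, y i ∈ Set.Icc (0:ℝ) 1) → x ≤ y → ∀ i, fgrad f y i ≤ fgrad f x i)
    {x y w : Fin n → ℝ} (hx : 0 ≤ x) (hxy : x ≤ y) (hyw : y ≤ w) (hw : w ≤ 1) :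
    ∑ i, (y i - x i) * fgrad f w i ≤ f y - f x := by
  obtain ⟨ξ, hξ, he⟩ := domain_mvt (s := Set.univ) (x := x) (y := y)
    (fun u _ => (hf u).hasFDerivAt.hasFDerivWithinAt) convex_univ (Set.mem_univ x) (Set.mem_univ y)
  obtain ⟨hxξ, hξy⟩ := segment_subset_Icc hxy hξ
  rw [he, fderiv_eq_sum_fgrad]
  refine Finset.sum_le_sum fun i _ => ?_
  exact mul_le_mul_of_nonneg_left
    (hDR ξ w (fun k => ⟨(hx k).trans (hxξ k), ((hξy.trans hyw) k).trans (hw k)⟩)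
      (fun k => ⟨(hx k).trans ((hxy.trans hyw) k), hw k⟩) (hξy.trans hyw) i)
    (sub_nonneg.2 (hxy i))

theorem smaxGrad_nonneg {m : ℕ} (η : ℝ) (z : Fin m → ℝ) (j : Fin m) : 0 ≤ smaxGrad η z j := by
  unfold smaxGrad
  positivity

/-- Second-order upper bound for the softmax function under small perturbations. -/
theorem smax_add_sub_le {m : ℕ} {η : ℝ} (hη : 0 < η) (z u : Fin m → ℝ)
    (hu : ∀ j, |u j / η| ≤ 1) :
    smax η (z + u) - smax η z ≤ ∑ j, smaxGrad η z j * (u j + u j ^ 2 / η) := by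
  rcases isEmpty_or_nonempty (Fin m) with hm | hm
  · simp [smax]
  have hS (v : Fin m → ℝ) : 0 < ∑ j, Real.exp (v j / η) :=
    Finset.sum_pos (fun j _ => Real.exp_pos _) Finset.univ_nonempty
  rw [smax, smax, ← mul_sub, ← Real.log_div (hS _).ne' (hS _).ne']
  have hlog := Real.log_le_sub_one_of_pos (div_pos (hS (z + u)) (hS z))
  refine (mul_le_mul_of_nonneg_left hlog hη.le).trans ?_
  have hterm : ∀ j, Real.exp ((z + u) j / η) ≤
      Real.exp (z j / η) + Real.exp (z j / η) * (u j / η + (u j / η) ^ 2) := fun j => by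
    have h := (abs_le.1 (Real.abs_exp_sub_one_sub_id_le (hu j))).2
    rw [Pi.add_apply, add_div, Real.exp_add]
    nlinarith [Real.exp_pos (z j / η)]
  have hsum := Finset.sum_le_sum fun j (_ : j ∈ Finset.univ) => hterm j
  rw [Finset.sum_add_distrib] at hsum
  have hratio : (∑ j, Real.exp ((z + u) j / η)) / (∑ j, Real.exp (z j / η)) - 1 ≤
      (∑ j, Real.exp (z j / η) * (u j / η + (u j / η) ^ 2)) / ∑ j, Real.exp (z j / η) := by
    rw [sub_le_iff_le_add, div_add_one (hS z).ne']
    exact div_le_div_of_nonneg_right (by linarith) (hS z).le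
  refine (mul_le_mul_of_nonneg_left hratio hη.le).trans (le_of_eq ?_)
  rw [Finset.sum_div, Finset.mul_sum]
  refine Finset.sum_congr rfl fun j _ => ?_
  rw [smaxGrad]
  field_simp

/-- Cauchy–Schwarz with nonnegative weights of total mass at most one. -/
theorem sq_sum_mul_le_sum_mul_sq {ι : Type*} (s : Finset ι) (w a : ι → ℝ)
    (hw : ∀ i ∈ s, 0 ≤ w i) (hs : ∑ i ∈ s, w i ≤ 1) :
    (∑ i ∈ s, w i * a i) ^ 2 ≤ ∑ i ∈ s, w i * a i ^ 2 := by
  refine (Finset.sum_sq_le_sum_mul_sum_of_sq_le_mul s hw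
    (g := fun i => w i * a i ^ 2)
    (fun i hi => mul_nonneg (hw i hi) (sq_nonneg _)) (fun i _ => le_of_eq (by ring))).trans ?_
  exact mul_le_of_le_one_left
    (Finset.sum_nonneg fun i hi => mul_nonneg (hw i hi) (sq_nonneg _)) hs

/-- the per-iteration progress guarantee of the non-monotone packing
algorithm: with `c_i = max((1-x_i) ∇_i f((1+η)x), 0)`,
`m_i = max(1 - λ (Aᵀ∇smax_η(Az))_i / c_i, 0)` (and `0` when `c_i = 0`), and
`d = η (x ∘ m)`, if `(1/η)‖Ad‖_∞ ≤ 1/2` then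
`f(x + d∘(1-x)) - f(x) ≥ λ (smax_η(A(z+d)) - smax_η(Az))`. -/
theorem stmt_14 (n m : ℕ) (f : (Fin n → ℝ) → ℝ) (hf : Differentiable ℝ f)
    (hDR : ∀ x y : Fin n → ℝ, (∀ i, x i ∈ Set.Icc (0:ℝ) 1) →
      (∀ i, y i ∈ Set.Icc (0:ℝ) 1) → x ≤ y → ∀ i, fgrad f y i ≤ fgrad f x i)
    (A : Matrix (Fin m) (Fin n) ℝ) (hA : ∀ j i, 0 ≤ A j i)
    (η lam : ℝ) (hη0 : 0 < η) (hη : η ≤ 1 / 2) (hlam : 0 < lam)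
    (x z : Fin n → ℝ) (hx : 0 ≤ x) (hxz : x ≤ z)
    (hbox : ∀ i, (1 + η) * x i ∈ Set.Icc (0:ℝ) 1)
    (hAz : ‖A.mulVec z‖ ≤ 1)
    (c M d : Fin n → ℝ)
    (hc : c = fun i => max ((1 - x i) * fgrad f ((1 + η) • x) i) 0)
    (hM : ∀ i, (0 < c i →
        M i = max (1 - lam * (∑ j, A j i * smaxGrad η (A.mulVec z) j) / c i) 0)
      ∧ (c i = 0 → M i = 0))
    (hd : d = fun i => η * (x i * M i))
    (hstep : (1 / η) * ‖A.mulVec d‖ ≤ 1 / 2) :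
    lam * (smax η (A.mulVec (z + d)) - smax η (A.mulVec z)) ≤
      f (fun i => x i + d i * (1 - x i)) - f x := by
  have hx1 : ∀ i, x i ≤ 1 := fun i => by nlinarith [hx i, (hbox i).2, mul_nonneg hη0.le (hx i)]
  set G : Fin n → ℝ := fun i => ∑ j, A j i * smaxGrad η (A.mulVec z) j with hG
  have hG0 : ∀ i, 0 ≤ G i := fun i =>
    Finset.sum_nonneg fun j _ => mul_nonneg (hA j i) (smaxGrad_nonneg _ _ _)
  have hc0 : ∀ i, 0 ≤ c i := fun i => by rw [hc]; exact le_max_right _ _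
  have hM01 : ∀ i, 0 ≤ M i ∧ M i ≤ 1 := fun i => by
    rcases (hc0 i).eq_or_lt with h | h
    · simp [(hM i).2 h.symm]
    · rw [(hM i).1 h]
      have : 0 ≤ lam * G i / c i := div_nonneg (mul_nonneg hlam.le (hG0 i)) h.le
      exact ⟨le_max_right _ _, max_le (sub_le_self _ this) zero_le_one⟩
  have hdi : ∀ i, d i = η * (x i * M i) := fun i => by rw [hd]
  have hd0 : ∀ i, 0 ≤ d i := fun i => by
    rw [hdi]; exact mul_nonneg hη0.le (mul_nonneg (hx i) (hM01 i).1)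
  have hf_lower := sum_mul_fgrad_le_sub hf hDR (x := x)
    (y := fun i => x i + d i * (1 - x i)) (w := (1 + η) • x) hx
    (fun i => le_add_of_nonneg_right (mul_nonneg (hd0 i) (sub_nonneg.2 (hx1 i))))
    (fun i => by
      have h1 : d i ≤ η * x i := by
        rw [hdi]
        exact mul_le_mul_of_nonneg_left (mul_le_of_le_one_right (hx i) (hM01 i).2) hη0.le
      have h2 : d i * (1 - x i) ≤ d i := mul_le_of_le_one_right (hd0 i) (sub_le_self _ (hx i))
      simp only [Pi.smul_apply, smul_eq_mul]
      linarith)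
    (fun i => (hbox i).2)
  refine le_trans ?_ hf_lower
  have hcoord : ∀ i, lam * (d i * G i * (1 + M i)) ≤
      (x i + d i * (1 - x i) - x i) * fgrad f ((1 + η) • x) i := fun i => by
    rcases (hM01 i).1.eq_or_lt with h | h
    · simp [hdi, ← h]
    have hci : 0 < c i := (hc0 i).lt_of_ne fun h0 => h.ne' ((hM i).2 h0.symm)
    have hce : c i = (1 - x i) * fgrad f ((1 + η) • x) i := by
      have h1 : c i = max ((1 - x i) * fgrad f ((1 + η) • x) i) 0 := by rw [hc]
      rcases max_choice ((1 - x i) * fgrad f ((1 + η) • x) i) 0 with h2 | h2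
      · rw [h1, h2]
      · exact absurd (h1.trans h2) hci.ne'
    have hMe : M i = 1 - lam * G i / c i := by
      have h1 := (hM i).1 hci
      rcases max_choice (1 - lam * G i / c i) 0 with h2 | h2
      · exact h1.trans h2
      · exact absurd (h1.trans h2) h.ne'
    have hMc : M i * c i = c i - lam * G i := by
      rw [hMe]; field_simp
    have hkey : lam * G i * (1 + M i) ≤ c i := by
      nlinarith [mul_nonneg h.le (mul_nonneg h.le hci.le)]
    calc lam * (d i * G i * (1 + M i)) = d i * (lam * G i * (1 + M i)) := by ring
      _ ≤ d i * c i := mul_le_mul_of_nonneg_left hkey (hd0 i)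
      _ = _ := by rw [hce]; ring
  refine le_trans ?_ (Finset.sum_le_sum fun i _ => hcoord i)
  rw [← Finset.mul_sum]
  refine mul_le_mul_of_nonneg_left ?_ hlam.le
  have hu : ∀ j, |A.mulVec d j / η| ≤ 1 := fun j => by
    rw [abs_div, abs_of_pos hη0, div_eq_inv_mul, ← one_div]
    have h := mul_le_mul_of_nonneg_left (norm_le_pi_norm (A.mulVec d) j)
      (one_div_nonneg.2 hη0.le)
    rw [Real.norm_eq_abs] at h
    linarith
  rw [Matrix.mulVec_add]
  refine (smax_add_sub_le hη0 _ _ hu).trans ?_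
  have hrow : ∀ j, ∑ i, A j i * x i ≤ 1 := fun j =>
    calc ∑ i, A j i * x i ≤ A.mulVec z j :=
          Finset.sum_le_sum fun i _ => mul_le_mul_of_nonneg_left (hxz i) (hA j i)
      _ ≤ ‖A.mulVec z‖ := (le_abs_self _).trans (norm_le_pi_norm (A.mulVec z) j)
      _ ≤ 1 := hAz
  have hquad : ∀ j, A.mulVec d j + A.mulVec d j ^ 2 / η ≤ ∑ i, A j i * (d i * (1 + M i)) :=
    fun j => by
      have hcs := sq_sum_mul_le_sum_mul_sq Finset.univ (fun i => A j i * x i) M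
        (fun i _ => mul_nonneg (hA j i) (hx i)) (hrow j)
      have he : A.mulVec d j = η * ∑ i, A j i * x i * M i := by
        rw [Matrix.mulVec, dotProduct, Finset.mul_sum]
        exact Finset.sum_congr rfl fun i _ => by rw [hdi]; ring
      have hsplit : ∑ i, A j i * (d i * (1 + M i)) =
          A.mulVec d j + η * ∑ i, A j i * x i * M i ^ 2 := by
        rw [he, ← mul_add, ← Finset.sum_add_distrib, Finset.mul_sum]
        exact Finset.sum_congr rfl fun i _ => by rw [hdi]; ring
      have hsq : A.mulVec d j ^ 2 / η = η * (∑ i, A j i * x i * M i) ^ 2 := by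
        rw [he]; field_simp
      rw [hsplit, hsq]
      exact add_le_add_right (mul_le_mul_of_nonneg_left hcs hη0.le) _
  refine (Finset.sum_le_sum fun j _ =>
    mul_le_mul_of_nonneg_left (hquad j) (smaxGrad_nonneg η (A.mulVec z) j)).trans (le_of_eq ?_)
  simp only [hG, Finset.mul_sum, Finset.sum_mul]
  rw [Finset.sum_comm]
  exact Finset.sum_congr rfl fun i _ => Finset.sum_congr rfl fun j _ => by ring
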